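/- arXiv:1803.06324 — 2 statements merged into one kernel-verified Lean document; each statement's English description precedes it below -/
import Mathlib

section
/- For every finite connected graph G, τ(G) = ι(G) ≤ 4·δ(G) and ς(G) ≤ 3·δ(G) + 1/2. -/
open SimpleGraph

noncomputable section

namespace HypPaper

variable {V : Type*}

/-- Gromov product `(y|z)_w = (d(y,w)+d(z,w)-d(y,z))/2`. -/
def gp (G : SimpleGraph V) (y z w : V) : ℝ :=
  ((G.dist y w : ℝ) + (G.dist z w : ℝ) - (G.dist y z : ℝ)) / 2

/-- `G` is `δ`-hyperbolic. -/
def IsDeltaHyp (G : SimpleGraph V) (δ : ℝ) : Prop :=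
  ∀ w x y z : V, gp G x y w ≥ min (gp G x z w) (gp G y z w) - δ

/-- The hyperbolicity `δ(G)`: least `δ ≥ 0` such that `G` is `δ`-hyperbolic. -/
def hyperbolicity (G : SimpleGraph V) : ℝ :=
  sInf {δ : ℝ | 0 ≤ δ ∧ IsDeltaHyp G δ}

/-- Pointed hyperbolicity `δ_w(G)` with respect to basepoint `w`. -/
def pointedHyp (G : SimpleGraph V) (w : V) : ℝ :=
  sInf {δ : ℝ | ∀ x y z : V, gp G x y w ≥ min (gp G x z w) (gp G y z w) - δ}

/-- A walk is a geodesic (shortest path) if its length equals the distance. -/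
def IsGeodesic (G : SimpleGraph V) {x y : V} (p : G.Walk x y) : Prop :=
  p.length = G.dist x y

/-- Thinness condition at corner `v` of a triangle, with sides `p : v → u` and `q : v → u'`. -/
def ThinCorner (G : SimpleGraph V) (δ : ℝ) {v u u' : V}
    (p : G.Walk v u) (q : G.Walk v u') : Prop :=
  ∀ a ∈ p.support, ∀ b ∈ q.support,
    G.dist v a = G.dist v b → (G.dist v a : ℝ) ≤ gp G u u' v →
    (G.dist a b : ℝ) ≤ δ

/-- A geodesic triangle with sides `p : x → y`, `q : y → z`, `r : z → x` is `δ`-thin. -/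
def TriangleThin (G : SimpleGraph V) (δ : ℝ) {x y z : V}
    (p : G.Walk x y) (q : G.Walk y z) (r : G.Walk z x) : Prop :=
  ThinCorner G δ p r.reverse ∧ ThinCorner G δ q p.reverse ∧ ThinCorner G δ r q.reverse

/-- Thinness `τ(G)`: least `δ` such that every geodesic triangle is `δ`-thin. -/
def thinness (G : SimpleGraph V) : ℝ :=
  sInf {δ : ℝ | ∀ (x y z : V) (p : G.Walk x y) (q : G.Walk y z) (r : G.Walk z x),
    IsGeodesic G p → IsGeodesic G q → IsGeodesic G r → TriangleThin G δ p q r}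

/-- The insize `max {d(y_z,z_y), d(z_x,x_z), d(x_y,y_x)}` of a geodesic triangle with
sides `p : x → y`, `q : y → z`, `r : z → x`. -/
def triInsize (G : SimpleGraph V) {x y z : V}
    (p : G.Walk x y) (q : G.Walk y z) (r : G.Walk z x) : ℝ :=
  max (G.dist (p.getVert ⌊gp G y z x⌋₊) (r.reverse.getVert ⌊gp G y z x⌋₊) : ℝ)
    (max (G.dist (q.getVert ⌊gp G z x y⌋₊) (p.reverse.getVert ⌊gp G z x y⌋₊) : ℝ)
      (G.dist (r.getVert ⌊gp G x y z⌋₊) (q.reverse.getVert ⌊gp G x y z⌋₊) : ℝ))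

/-- Insize `ι(G)`: least upper bound on insizes of geodesic triangles. -/
def insize (G : SimpleGraph V) : ℝ :=
  sInf {δ : ℝ | ∀ (x y z : V) (p : G.Walk x y) (q : G.Walk y z) (r : G.Walk z x),
    IsGeodesic G p → IsGeodesic G q → IsGeodesic G r → triInsize G p q r ≤ δ}

/-- A geodesic triangle with sides `p : x → y`, `q : y → z`, `r : z → x` is `δ`-slim. -/
def TriangleSlim (G : SimpleGraph V) (δ : ℝ) {x y z : V}
    (p : G.Walk x y) (q : G.Walk y z) (r : G.Walk z x) : Prop :=
  (∀ a ∈ p.support, ∃ b, (b ∈ q.support ∨ b ∈ r.support) ∧ (G.dist a b : ℝ) ≤ δ) ∧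
  (∀ a ∈ q.support, ∃ b, (b ∈ r.support ∨ b ∈ p.support) ∧ (G.dist a b : ℝ) ≤ δ) ∧
  (∀ a ∈ r.support, ∃ b, (b ∈ p.support ∨ b ∈ q.support) ∧ (G.dist a b : ℝ) ≤ δ)

/-- Slimness `ς(G)`: least `δ` such that every geodesic triangle is `δ`-slim. -/
def slimness (G : SimpleGraph V) : ℝ :=
  sInf {δ : ℝ | ∀ (x y z : V) (p : G.Walk x y) (q : G.Walk y z) (r : G.Walk z x),
    IsGeodesic G p → IsGeodesic G q → IsGeodesic G r → TriangleSlim G δ p q r}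

/-- The metric interval `I(u,v)`. -/
def interval (G : SimpleGraph V) (u v : V) : Set V :=
  {x | G.dist u x + G.dist x v = G.dist u v}

/-- Interval thinness `κ(G)`. -/
def intervalThinness (G : SimpleGraph V) : ℝ :=
  sInf {κ : ℝ | ∀ x y a b : V, a ∈ interval G x y → b ∈ interval G x y →
    G.dist x a = G.dist x b → (G.dist a b : ℝ) ≤ κ}

/-- A BFS-tree of `G` rooted at `w`: a spanning tree (encoded by its parent function)
in which the path from `w` to any vertex is a shortest path of `G`. -/
structure BFSTree (G : SimpleGraph V) (w : V) where
  parent : V → V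
  parent_root : parent w = w
  adj_parent : ∀ x, x ≠ w → G.Adj (parent x) x
  dist_parent : ∀ x, x ≠ w → G.dist w (parent x) + 1 = G.dist w x

/-- The vertex of the tree path `[w,x]_T` at distance `r` from the root `w`
(for `r ≤ d(w,x)`). -/
def treeVert (G : SimpleGraph V) {w : V} (T : BFSTree G w) (x : V) (r : ℕ) : V :=
  T.parent^[G.dist w x - r] x

/-- `v` lies on the tree path `[w,x]_T`. -/
def onRootPath (G : SimpleGraph V) {w : V} (T : BFSTree G w) (x v : V) : Prop :=
  ∃ i ≤ G.dist w x, v = T.parent^[i] x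

/-- The rooted insize `ρ_{w,T}(G) = max {d(x_y, y_x) : x, y ∈ V}`, where `x_y`, `y_x` are
the vertices of `[w,x]_T`, `[w,y]_T` at distance `⌊(x|y)_w⌋` from `w`. -/
def rootedInsize (G : SimpleGraph V) {w : V} (T : BFSTree G w) : ℝ :=
  sSup {ρ : ℝ | ∃ x y : V,
    ρ = (G.dist (treeVert G T x ⌊gp G x y w⌋₊) (treeVert G T y ⌊gp G x y w⌋₊) : ℝ)}

/-- The rooted thinness `μ_{w,T}(G)`. -/
def rootedThinness (G : SimpleGraph V) {w : V} (T : BFSTree G w) : ℝ :=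
  sSup {μ : ℝ | ∃ x y x' y' : V, onRootPath G T x x' ∧ onRootPath G T y y' ∧
    G.dist w x' = G.dist w y' ∧ (G.dist w x' : ℝ) ≤ gp G x y w ∧
    μ = (G.dist x' y' : ℝ)}


section Geodesics

variable {G : SimpleGraph V} {v u u' : V}

lemma IsGeodesic.reverse {p : G.Walk v u} (hp : IsGeodesic G p) : IsGeodesic G p.reverse := by
  unfold IsGeodesic at *
  rw [Walk.length_reverse, hp, SimpleGraph.dist_comm]

lemma IsGeodesic.dist_getVert_left (hG : G.Connected) {p : G.Walk v u} (hp : IsGeodesic G p)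
    {i : ℕ} (hi : i ≤ p.length) : G.dist v (p.getVert i) = i := by
  have h₁ := dist_le (p.take i)
  have h₂ := dist_le (p.drop i)
  have h₃ := hG.dist_triangle (u := v) (v := p.getVert i) (w := u)
  rw [Walk.take_length] at h₁
  rw [Walk.drop_length] at h₂
  unfold IsGeodesic at hp
  omega

lemma IsGeodesic.dist_getVert_right (hG : G.Connected) {p : G.Walk v u} (hp : IsGeodesic G p)
    {i : ℕ} (hi : i ≤ p.length) : i + G.dist (p.getVert i) u = G.dist v u := by
  have h₁ := hp.dist_getVert_left hG hi
  have h₂ := dist_le (p.drop i)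
  have h₃ := hG.dist_triangle (u := v) (v := p.getVert i) (w := u)
  rw [Walk.drop_length] at h₂
  unfold IsGeodesic at hp
  omega

lemma IsGeodesic.take (hG : G.Connected) {p : G.Walk v u} (hp : IsGeodesic G p)
    {i : ℕ} (hi : i ≤ p.length) : IsGeodesic G (p.take i) := by
  unfold IsGeodesic
  rw [Walk.take_length, hp.dist_getVert_left hG hi, min_eq_left hi]

lemma IsGeodesic.getVert_dist (hG : G.Connected) {p : G.Walk v u} (hp : IsGeodesic G p)
    {a : V} (ha : a ∈ p.support) : p.getVert (G.dist v a) = a := by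
  obtain ⟨i, rfl, hi⟩ := Walk.mem_support_iff_exists_getVert.mp ha
  rw [hp.dist_getVert_left hG hi]

lemma IsGeodesic.dist_add_dist (hG : G.Connected) {p : G.Walk v u} (hp : IsGeodesic G p)
    {a : V} (ha : a ∈ p.support) : G.dist v a + G.dist a u = G.dist v u := by
  obtain ⟨i, rfl, hi⟩ := Walk.mem_support_iff_exists_getVert.mp ha
  rw [hp.dist_getVert_left hG hi, hp.dist_getVert_right hG hi]

lemma dist_triangle_real (hG : G.Connected) (x y z : V) :
    (G.dist x z : ℝ) ≤ G.dist x y + G.dist y z := by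
  exact_mod_cast hG.dist_triangle

lemma gp_nonneg (hG : G.Connected) (y z w : V) : 0 ≤ gp G y z w := by
  have h := dist_triangle_real hG y w z
  rw [G.dist_comm (u := w)] at h
  unfold gp
  linarith

lemma gp_comm (y z w : V) : gp G y z w = gp G z y w := by
  unfold gp
  rw [G.dist_comm (u := y) (v := z)]
  ring

lemma gp_le_dist (hG : G.Connected) (y z w : V) : gp G y z w ≤ G.dist w y := by
  have h := dist_triangle_real hG z y w
  rw [G.dist_comm (u := z) (v := y)] at h
  unfold gp
  rw [G.dist_comm (u := w) (v := y)]
  linarith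

end Geodesics

section Thinness

variable {G : SimpleGraph V} {δ : ℝ} {v u u' : V}

/-- Along two geodesics issued from `v`, one can stop at vertices whose Gromov product at `v`
has any prescribed integer part `k` not exceeding the Gromov product of the endpoints. -/
lemma exists_floor_gp_eq (hG : G.Connected) {p : G.Walk v u} {q : G.Walk v u'}
    (hp : IsGeodesic G p) (hq : IsGeodesic G q) {k : ℕ} (hk : (k : ℝ) ≤ gp G u u' v) :
    ∃ s t, k ≤ s ∧ s ≤ p.length ∧ k ≤ t ∧ t ≤ q.length ∧
      ⌊gp G (p.getVert s) (q.getVert t) v⌋₊ = k := by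
  have key : ∀ n s t : ℕ, s + t = n → k ≤ s → s ≤ p.length → k ≤ t → t ≤ q.length →
      2 * k + G.dist (p.getVert s) (q.getVert t) ≤ s + t →
      ∃ s t, k ≤ s ∧ s ≤ p.length ∧ k ≤ t ∧ t ≤ q.length ∧
        2 * k + G.dist (p.getVert s) (q.getVert t) ≤ s + t ∧
        s + t ≤ 2 * k + 1 + G.dist (p.getVert s) (q.getVert t) := by
    intro n
    induction n with
    | zero =>
      intro s t hn hs hsp ht htq h
      exact ⟨s, t, hs, hsp, ht, htq, h, by omega⟩
    | succ n ih =>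
      intro s t hn hs hsp ht htq h
      by_cases hle : s + t ≤ 2 * k + 1 + G.dist (p.getVert s) (q.getVert t)
      · exact ⟨s, t, hs, hsp, ht, htq, h, hle⟩
      rcases hs.lt_or_eq with hs' | rfl
      · obtain ⟨s, rfl⟩ : ∃ j, s = j + 1 := ⟨s - 1, by omega⟩
        have hd := hG.dist_triangle (u := p.getVert s) (v := p.getVert (s + 1))
          (w := q.getVert t)
        rw [dist_eq_one_iff_adj.mpr (p.adj_getVert_succ (by omega))] at hd
        exact ih s t (by omega) (by omega) (by omega) ht htq (by omega)
      · obtain ⟨t, rfl⟩ : ∃ j, t = j + 1 := ⟨t - 1, by omega⟩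
        have hd := hG.dist_triangle (u := p.getVert k) (v := q.getVert (t + 1))
          (w := q.getVert t)
        rw [dist_eq_one_iff_adj.mpr (q.adj_getVert_succ (by omega)).symm] at hd
        exact ih k t (by omega) hs hsp (by omega) (by omega) (by omega)
  have hkp : k ≤ p.length := by
    rw [hp]
    exact_mod_cast hk.trans (gp_le_dist hG u u' v)
  have hkq : k ≤ q.length := by
    rw [hq]
    exact_mod_cast (hk.trans_eq (gp_comm u u' v)).trans (gp_le_dist hG u' u v)
  have hend : 2 * k + G.dist (p.getVert p.length) (q.getVert q.length) ≤ p.length + q.length := by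
    rw [Walk.getVert_length, Walk.getVert_length, hp, hq, G.dist_comm (u := v),
      G.dist_comm (u := v)]
    unfold gp at hk
    have : (2 * k + G.dist u u' : ℝ) ≤ G.dist u v + G.dist u' v := by linarith
    exact_mod_cast this
  obtain ⟨s, t, hs, hsp, ht, htq, h₁, h₂⟩ :=
    key _ p.length q.length rfl hkp le_rfl hkq le_rfl hend
  refine ⟨s, t, hs, hsp, ht, htq, ?_⟩
  have h₁' : (2 * k + G.dist (p.getVert s) (q.getVert t) : ℝ) ≤ s + t := by exact_mod_cast h₁
  have h₂' : (s + t : ℝ) ≤ 2 * k + 1 + G.dist (p.getVert s) (q.getVert t) := by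
    exact_mod_cast h₂
  rw [Nat.floor_eq_iff (gp_nonneg hG _ _ _)]
  unfold gp
  rw [G.dist_comm (v := v), G.dist_comm (u := q.getVert t) (v := v),
    hp.dist_getVert_left hG hsp, hq.dist_getVert_left hG htq]
  constructor <;> linarith

lemma thinCorner_of_triInsize_le (hG : G.Connected)
    (h : ∀ (x y z : V) (p : G.Walk x y) (q : G.Walk y z) (r : G.Walk z x),
      IsGeodesic G p → IsGeodesic G q → IsGeodesic G r → triInsize G p q r ≤ δ)
    {p : G.Walk v u} {q : G.Walk v u'} (hp : IsGeodesic G p) (hq : IsGeodesic G q) :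
    ThinCorner G δ p q := by
  intro a ha b hb hab hk
  obtain ⟨s, t, hs, hsp, ht, htq, hfloor⟩ := exists_floor_gp_eq hG hp hq hk
  obtain ⟨r, hr⟩ := hG.exists_walk_length_eq_dist (p.getVert s) (q.getVert t)
  have hle := (le_max_left _ _).trans
    (h _ _ _ (p.take s) r (q.take t).reverse (hp.take hG hsp) hr (hq.take hG htq).reverse)
  rw [hfloor, Walk.reverse_reverse, Walk.take_getVert, Walk.take_getVert, min_eq_right hs,
    min_eq_right ht, hp.getVert_dist hG ha, hab, hq.getVert_dist hG hb] at hle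
  exact hle

lemma ThinCorner.dist_getVert_floor_le (hG : G.Connected) {p : G.Walk v u} {q : G.Walk v u'}
    (hp : IsGeodesic G p) (hq : IsGeodesic G q) (h : ThinCorner G δ p q) :
    (G.dist (p.getVert ⌊gp G u u' v⌋₊) (q.getVert ⌊gp G u u' v⌋₊) : ℝ) ≤ δ := by
  have hk := Nat.floor_le (gp_nonneg hG u u' v)
  have hkp : ⌊gp G u u' v⌋₊ ≤ p.length := by
    rw [hp]
    exact_mod_cast hk.trans (gp_le_dist hG u u' v)
  have hkq : ⌊gp G u u' v⌋₊ ≤ q.length := by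
    rw [hq]
    exact_mod_cast (hk.trans_eq (gp_comm u u' v)).trans (gp_le_dist hG u' u v)
  refine h _ (p.getVert_mem_support _) _ (q.getVert_mem_support _) ?_ ?_
  · rw [hp.dist_getVert_left hG hkp, hq.dist_getVert_left hG hkq]
  · rwa [hp.dist_getVert_left hG hkp]

lemma TriangleThin.triInsize_le (hG : G.Connected) {x y z : V} {p : G.Walk x y}
    {q : G.Walk y z} {r : G.Walk z x} (hp : IsGeodesic G p) (hq : IsGeodesic G q)
    (hr : IsGeodesic G r) (h : TriangleThin G δ p q r) : triInsize G p q r ≤ δ :=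
  max_le (h.1.dist_getVert_floor_le hG hp hr.reverse)
    (max_le (h.2.1.dist_getVert_floor_le hG hq hp.reverse)
      (h.2.2.dist_getVert_floor_le hG hr hq.reverse))

lemma thinness_eq_insize (hG : G.Connected) : thinness G = insize G := by
  unfold thinness insize
  congr 1
  ext δ
  refine ⟨fun h x y z p q r hp hq hr => (h x y z p q r hp hq hr).triInsize_le hG hp hq hr,
    fun h x y z p q r hp hq hr => ⟨?_, ?_, ?_⟩⟩
  · exact thinCorner_of_triInsize_le hG h hp hr.reverse
  · exact thinCorner_of_triInsize_le hG h hq hp.reverse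
  · exact thinCorner_of_triInsize_le hG h hr hq.reverse

end Thinness

section Hyperbolicity

variable {G : SimpleGraph V} {δ : ℝ}

lemma isDeltaHyp_hyperbolicity [Finite V] (G : SimpleGraph V) :
    IsDeltaHyp G (hyperbolicity G) := by
  have hne : {δ : ℝ | 0 ≤ δ ∧ IsDeltaHyp G δ}.Nonempty := by
    obtain ⟨M, hM⟩ := (Set.finite_range fun a : V × V × V × V =>
      min (gp G a.2.1 a.2.2.2 a.1) (gp G a.2.2.1 a.2.2.2 a.1) - gp G a.2.1 a.2.2.1 a.1).bddAbove
    refine ⟨max 0 M, le_max_left _ _, fun w x y z => ?_⟩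
    have h₁ : min (gp G x z w) (gp G y z w) - gp G x y w ≤ M := hM ⟨(w, x, y, z), rfl⟩
    have h₂ := le_max_right 0 M
    linarith
  intro w x y z
  have h : min (gp G x z w) (gp G y z w) - gp G x y w ≤ hyperbolicity G :=
    le_csInf hne fun δ hδ => by linarith [hδ.2 w x y z]
  linarith

lemma IsDeltaHyp.four_point (h : IsDeltaHyp G δ) (w x y z : V) :
    (G.dist x y + G.dist z w : ℝ) ≤ G.dist x z + G.dist y w + 2 * δ ∨
      (G.dist x y + G.dist z w : ℝ) ≤ G.dist y z + G.dist x w + 2 * δ := by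
  have h' := h w x y z
  unfold gp at h'
  rcases min_le_iff.mp (show min _ _ ≤ _ from sub_le_iff_le_add.mp h') with h' | h'
  · left; linarith
  · right; linarith

lemma IsDeltaHyp.thinCorner (hG : G.Connected) (h : IsDeltaHyp G δ) {v u u' : V}
    {p : G.Walk v u} {q : G.Walk v u'} (hp : IsGeodesic G p) (hq : IsGeodesic G q) :
    ThinCorner G (4 * δ) p q := by
  intro a ha b hb hab hk
  have h₁ := h v a u' u
  have h₂ := h v a b u'
  have hpa : (G.dist v a + G.dist a u : ℝ) = G.dist v u := by
    exact_mod_cast hp.dist_add_dist hG ha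
  have hqb : (G.dist v b + G.dist b u' : ℝ) = G.dist v u' := by
    exact_mod_cast hq.dist_add_dist hG hb
  have hab' : (G.dist v a : ℝ) = G.dist v b := by exact_mod_cast hab
  have hau : gp G a u v = G.dist v a := by
    unfold gp
    rw [G.dist_comm (u := a) (v := v), G.dist_comm (u := u) (v := v)]
    linarith
  have hbu : gp G b u' v = G.dist v a := by
    unfold gp
    rw [G.dist_comm (u := b) (v := v), G.dist_comm (u := u') (v := v)]
    linarith
  have hdist : gp G a b v = G.dist v a - G.dist a b / 2 := by
    unfold gp
    rw [G.dist_comm (u := a) (v := v), G.dist_comm (u := b) (v := v)]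
    linarith
  rw [hau, gp_comm u' u, min_eq_left hk] at h₁
  rw [hbu, hdist] at h₂
  have hδ : 0 ≤ δ := by
    have := h v v v v
    rw [min_self] at this
    linarith
  have h₃ : (G.dist v a : ℝ) - δ ≤ min (gp G a u' v) (G.dist v a) :=
    le_min h₁ (by linarith)
  linarith

lemma IsDeltaHyp.exists_mem_support_dist_le (hG : G.Connected) (h : IsDeltaHyp G δ)
    {y z : V} {q : G.Walk y z} (hq : IsGeodesic G q) {a : V}
    (ha : (G.dist a y + G.dist a z : ℝ) ≤ G.dist y z + 2 * δ) :
    ∃ b ∈ q.support, (G.dist a b : ℝ) ≤ 3 * δ + 1 / 2 := by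
  obtain ⟨t, htq, ht₁, ht₂⟩ : ∃ t ≤ q.length, 2 * t + G.dist a z ≤ G.dist a y + G.dist y z ∧
      G.dist a y + G.dist y z ≤ 2 * t + G.dist a z + 1 := by
    have h₁ := hG.dist_triangle (u := a) (v := y) (w := z)
    have h₂ := hG.dist_triangle (u := a) (v := z) (w := y)
    rw [G.dist_comm (u := z)] at h₂
    rw [hq]
    exact ⟨(G.dist a y + G.dist y z - G.dist a z) / 2, by omega, by omega, by omega⟩
  refine ⟨q.getVert t, q.getVert_mem_support t, ?_⟩
  have hy : (G.dist y (q.getVert t) : ℝ) = t := by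
    exact_mod_cast hq.dist_getVert_left hG htq
  have hz : (t + G.dist (q.getVert t) z : ℝ) = G.dist y z := by
    exact_mod_cast hq.dist_getVert_right hG htq
  have ht₁' : (2 * t + G.dist a z : ℝ) ≤ G.dist a y + G.dist y z := by exact_mod_cast ht₁
  have ht₂' : (G.dist a y + G.dist y z : ℝ) ≤ 2 * t + G.dist a z + 1 := by exact_mod_cast ht₂
  rcases h.four_point z a (q.getVert t) y with h' | h'
  · linarith
  · rw [G.dist_comm (u := q.getVert t) (v := y)] at h'
    linarith

lemma IsDeltaHyp.exists_mem_sides_dist_le (hG : G.Connected) (h : IsDeltaHyp G δ)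
    {x y z : V} {p : G.Walk x y} {q : G.Walk y z} {r : G.Walk z x} (hp : IsGeodesic G p)
    (hq : IsGeodesic G q) (hr : IsGeodesic G r) {a : V} (ha : a ∈ p.support) :
    ∃ b, (b ∈ q.support ∨ b ∈ r.support) ∧ (G.dist a b : ℝ) ≤ 3 * δ + 1 / 2 := by
  have hpa : (G.dist x a + G.dist a y : ℝ) = G.dist x y := by
    exact_mod_cast hp.dist_add_dist hG ha
  rcases h.four_point z x y a with h' | h'
  · obtain ⟨b, hb, hab⟩ := h.exists_mem_support_dist_le hG hq (a := a) (by linarith)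
    exact ⟨b, .inl hb, hab⟩
  · rw [G.dist_comm (u := y) (v := a), G.dist_comm (u := x) (v := z)] at h'
    rw [G.dist_comm (u := x) (v := a)] at hpa
    obtain ⟨b, hb, hab⟩ := h.exists_mem_support_dist_le hG hr (a := a) (by linarith)
    exact ⟨b, .inr hb, hab⟩

lemma IsDeltaHyp.triangleSlim (hG : G.Connected) (h : IsDeltaHyp G δ)
    {x y z : V} {p : G.Walk x y} {q : G.Walk y z} {r : G.Walk z x} (hp : IsGeodesic G p)
    (hq : IsGeodesic G q) (hr : IsGeodesic G r) : TriangleSlim G (3 * δ + 1 / 2) p q r :=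
  ⟨fun _ => h.exists_mem_sides_dist_le hG hp hq hr,
    fun _ => h.exists_mem_sides_dist_le hG hq hr hp,
    fun _ => h.exists_mem_sides_dist_le hG hr hp hq⟩

lemma insize_le_of_isDeltaHyp (hG : G.Connected) (h : IsDeltaHyp G δ) : insize G ≤ 4 * δ := by
  obtain ⟨v⟩ := hG.nonempty
  refine csInf_le ⟨0, fun ε hε => ?_⟩ fun x y z p q r hp hq hr => ?_
  · have hnil : IsGeodesic G (Walk.nil : G.Walk v v) := by simp [IsGeodesic]
    exact (Nat.cast_nonneg _).trans ((le_max_left _ _).trans (hε v v v _ _ _ hnil hnil hnil))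
  · exact TriangleThin.triInsize_le hG hp hq hr ⟨h.thinCorner hG hp hr.reverse,
      h.thinCorner hG hq hp.reverse, h.thinCorner hG hr hq.reverse⟩

lemma slimness_le_of_isDeltaHyp (hG : G.Connected) (h : IsDeltaHyp G δ) :
    slimness G ≤ 3 * δ + 1 / 2 := by
  obtain ⟨v⟩ := hG.nonempty
  refine csInf_le ⟨0, fun ε hε => ?_⟩ fun x y z p q r hp hq hr => h.triangleSlim hG hp hq hr
  have hnil : IsGeodesic G (Walk.nil : G.Walk v v) := by simp [IsGeodesic]
  obtain ⟨b, -, hb⟩ := (hε v v v _ _ _ hnil hnil hnil).1 v (by simp)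
  exact (Nat.cast_nonneg _).trans hb

end Hyperbolicity

/-- For every finite connected graph `G`, `τ(G) = ι(G) ≤ 4·δ(G)` and `ς(G) ≤ 3·δ(G) + 1/2`. -/
theorem thinness_eq_insize_le_four_hyp_and_slimness_le
    {V : Type*} [Fintype V] (G : SimpleGraph V) (hG : G.Connected) :
    thinness G = insize G ∧ insize G ≤ 4 * hyperbolicity G ∧
      slimness G ≤ 3 * hyperbolicity G + 1 / 2 := by
  have h := isDeltaHyp_hyperbolicity G
  exact ⟨thinness_eq_insize hG, insize_le_of_isDeltaHyp hG h, slimness_le_of_isDeltaHyp hG h⟩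

end HypPaper
end
end

section
/- For every finite connected graph G, δ(G) ≤ τ(G) + 1/2. -/
open SimpleGraph

noncomputable section

namespace HypPaper

variable {V : Type*}

/-- On a geodesic, the vertex at step `r` is at distance `r` from the start, and at the
complementary distance from the end. -/
theorem IsGeodesic.dist_getVert {G : SimpleGraph V} {u v : V} {p : G.Walk u v}
    (hp : IsGeodesic G p) {r : ℕ} (hr : r ≤ G.dist u v) :
    G.dist u (p.getVert r) = r ∧ G.dist (p.getVert r) v = G.dist u v - r := by
  have hlen : p.length = G.dist u v := hp
  have htake := dist_le (p.take r)
  have hdrop := dist_le (p.drop r)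
  rw [Walk.take_length] at htake
  rw [Walk.drop_length] at hdrop
  have htri := (p.take r).reachable.dist_triangle_left v
  omega

/-- A thinness bound controls the distance between vertices at equal distance along two
geodesics issuing from the same vertex. -/
theorem dist_getVert_le_of_thin {G : SimpleGraph V} (hG : G.Connected) {δ : ℝ}
    (hδ : ∀ (x y z : V) (p : G.Walk x y) (q : G.Walk y z) (r : G.Walk z x),
      IsGeodesic G p → IsGeodesic G q → IsGeodesic G r → TriangleThin G δ p q r)
    {w x z : V} {p : G.Walk w x} {q : G.Walk w z} (hp : IsGeodesic G p)
    (hq : IsGeodesic G q) {r : ℕ} (hx : r ≤ G.dist w x) (hz : r ≤ G.dist w z)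
    (hr : (r : ℝ) ≤ gp G x z w) :
    (G.dist (p.getVert r) (q.getVert r) : ℝ) ≤ δ := by
  obtain ⟨s, hs⟩ := hG.exists_walk_length_eq_dist x z
  have hq' : IsGeodesic G q.reverse := by
    unfold IsGeodesic at *
    rw [Walk.length_reverse, hq, G.dist_comm]
  have hthin := (hδ w x z p s q.reverse hp hs hq').1
  have ha := (hp.dist_getVert hx).1
  have hb := (hq.dist_getVert hz).1
  refine hthin _ (p.getVert_mem_support r) _ ?_ (ha.trans hb.symm) (by rwa [ha])
  rw [Walk.reverse_reverse]
  exact q.getVert_mem_support r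

/-- A graph all of whose geodesic triangles are `δ`-thin is `(δ + 1/2)`-hyperbolic. -/
theorem isDeltaHyp_of_thin {G : SimpleGraph V} (hG : G.Connected) {δ : ℝ}
    (hδ : ∀ (x y z : V) (p : G.Walk x y) (q : G.Walk y z) (r : G.Walk z x),
      IsGeodesic G p → IsGeodesic G q → IsGeodesic G r → TriangleThin G δ p q r) :
    IsDeltaHyp G (δ + 1 / 2) := by
  intro w x y z
  obtain ⟨p, hp⟩ := hG.exists_walk_length_eq_dist w x
  obtain ⟨q, hq⟩ := hG.exists_walk_length_eq_dist w y
  obtain ⟨s, hs⟩ := hG.exists_walk_length_eq_dist w z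
  have hxz : G.dist x z ≤ G.dist w x + G.dist w z := by
    simpa only [G.dist_comm (u := x) (v := w)] using hG.dist_triangle (u := x) (v := w) (w := z)
  have hyz : G.dist y z ≤ G.dist w y + G.dist w z := by
    simpa only [G.dist_comm (u := y) (v := w)] using hG.dist_triangle (u := y) (v := w) (w := z)
  have hwx : G.dist w x ≤ G.dist w z + G.dist x z := by
    simpa only [G.dist_comm (u := z) (v := x)] using hG.dist_triangle (u := w) (v := z) (w := x)
  have hwy : G.dist w y ≤ G.dist w z + G.dist y z := by
    simpa only [G.dist_comm (u := z) (v := y)] using hG.dist_triangle (u := w) (v := z) (w := y)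
  have hwz : G.dist w z ≤ G.dist w x + G.dist x z := hG.dist_triangle
  have hwz' : G.dist w z ≤ G.dist w y + G.dist y z := hG.dist_triangle
  -- `r` is the integer part of the smaller of the two Gromov products.
  obtain ⟨r, hrx, hry, hr⟩ : ∃ r : ℕ, 2 * r + G.dist x z ≤ G.dist w x + G.dist w z ∧
      2 * r + G.dist y z ≤ G.dist w y + G.dist w z ∧
      (G.dist w x + G.dist w z ≤ 2 * r + 1 + G.dist x z ∨
        G.dist w y + G.dist w z ≤ 2 * r + 1 + G.dist y z) :=
    ⟨min (G.dist w x + G.dist w z - G.dist x z) (G.dist w y + G.dist w z - G.dist y z) / 2,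
      by omega, by omega, by omega⟩
  have hpa := (IsGeodesic.dist_getVert hp (r := r) (by omega)).2
  have hqb := (IsGeodesic.dist_getVert hq (r := r) (by omega)).2
  have hac := dist_getVert_le_of_thin hG hδ hp hs (r := r) (by omega) (by omega) (by
    rw [gp, G.dist_comm (u := x) (v := w), G.dist_comm (u := z) (v := w)]
    have : (2 * r + G.dist x z : ℝ) ≤ G.dist w x + G.dist w z := mod_cast hrx
    linarith)
  have hbc := dist_getVert_le_of_thin hG hδ hq hs (r := r) (by omega) (by omega) (by
    rw [gp, G.dist_comm (u := y) (v := w),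
      G.dist_comm (u := z) (v := w)]
    have : (2 * r + G.dist y z : ℝ) ≤ G.dist w y + G.dist w z := mod_cast hry
    linarith)
  have hxy : G.dist x y + 2 * r ≤ G.dist w x + G.dist w y +
      G.dist (p.getVert r) (s.getVert r) + G.dist (q.getVert r) (s.getVert r) := by
    have h₁ : G.dist x y ≤ G.dist x (p.getVert r) + G.dist (p.getVert r) y := hG.dist_triangle
    have h₂ : G.dist (p.getVert r) y ≤
        G.dist (p.getVert r) (s.getVert r) + G.dist (s.getVert r) y := hG.dist_triangle
    have h₃ : G.dist (s.getVert r) y ≤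
        G.dist (s.getVert r) (q.getVert r) + G.dist (q.getVert r) y := hG.dist_triangle
    rw [G.dist_comm (u := x) (v := p.getVert r)] at h₁
    rw [G.dist_comm (u := s.getVert r) (v := q.getVert r)] at h₃
    omega
  have hxy' : (G.dist x y + 2 * r : ℝ) ≤ G.dist w x + G.dist w y +
      G.dist (p.getVert r) (s.getVert r) + G.dist (q.getVert r) (s.getVert r) := mod_cast hxy
  have hmin : min (gp G x z w) (gp G y z w) ≤ r + 1 / 2 := by
    rw [min_le_iff, gp, gp, G.dist_comm (u := x) (v := w), G.dist_comm (u := y) (v := w),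
      G.dist_comm (u := z) (v := w)]
    refine hr.imp (fun h => ?_) (fun h => ?_)
    · have : (G.dist w x + G.dist w z : ℝ) ≤ 2 * r + 1 + G.dist x z := mod_cast h
      linarith
    · have : (G.dist w y + G.dist w z : ℝ) ≤ 2 * r + 1 + G.dist y z := mod_cast h
      linarith
  have hgp : (r : ℝ) - δ ≤ gp G x y w := by
    rw [gp, G.dist_comm (u := x) (v := w), G.dist_comm (u := y) (v := w)]
    linarith
  linarith

/-- In a finite graph some `δ` makes every geodesic triangle thin. -/
theorem exists_thin [Finite V] (G : SimpleGraph V) :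
    ∃ δ : ℝ, ∀ (x y z : V) (p : G.Walk x y) (q : G.Walk y z) (r : G.Walk z x),
      IsGeodesic G p → IsGeodesic G q → IsGeodesic G r → TriangleThin G δ p q r := by
  obtain ⟨δ, hδ⟩ := (Set.finite_range fun u : V × V => (G.dist u.1 u.2 : ℝ)).bddAbove
  have hle (a b : V) : (G.dist a b : ℝ) ≤ δ := hδ ⟨(a, b), rfl⟩
  exact ⟨δ, fun _ _ _ _ _ _ _ _ _ => ⟨fun a _ b _ _ _ => hle a b,
    fun a _ b _ _ _ => hle a b, fun a _ b _ _ _ => hle a b⟩⟩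

/-- For every finite connected graph `G`, `δ(G) ≤ τ(G) + 1/2`. -/
theorem hyperbolicity_le_thinness_add_half
    {V : Type*} [Fintype V] (G : SimpleGraph V) (hG : G.Connected) :
    hyperbolicity G ≤ thinness G + 1 / 2 := by
  rw [← sub_le_iff_le_add]
  refine le_csInf (exists_thin G) fun δ hδ => ?_
  rw [sub_le_iff_le_add]
  have hδ_nonneg : 0 ≤ δ := by
    obtain ⟨v⟩ := hG.nonempty
    have hnil : IsGeodesic G (Walk.nil : G.Walk v v) := by simp [IsGeodesic]
    simpa using dist_getVert_le_of_thin hG hδ hnil hnil (r := 0) (by simp) (by simp)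
      (by simp [gp])
  exact csInf_le ⟨0, fun _ h => h.1⟩ ⟨by positivity, isDeltaHyp_of_thin hG hδ⟩

end HypPaper
end
end
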